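/- Let A = ⊕_{k≥0} A_k be an affine graded integral domain over a field F with A_0 = F. For any F-subalgebra R of A, let R̃ be the F-span of the initial (lowest-degree homogeneous) components of the nonzero elements of R, a graded F-subalgebra of A. Then the transcendence degree of R̃ over F equals the transcendence degree of R over F. -/

import Mathlib

open DirectSum

/-- The transcendence degree over `F` of a subset `S` of an `F`-algebra `A`: the supremum of
the cardinalities of algebraically independent (over `F`) subsets contained in `S`. -/
noncomputable def setTrdeg (F : Type*) {A : Type*} [Field F] [CommRing A] [Algebra F A]
    (S : Set A) : Cardinal :=
  ⨆ s : {s : Set A // s ⊆ S ∧ AlgebraicIndependent F ((↑) : s → A)}, Cardinal.mk s.1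

theorem Nat.le_of_forall_pow_le {a b C : ℕ} (h : ∀ m : ℕ, (m + 1) ^ a ≤ C * (m + 1) ^ b) :
    a ≤ b := by
  by_contra! hlt
  have h1 : (C + 1) ^ (b + 1) ≤ C * (C + 1) ^ b :=
    (Nat.pow_le_pow_right (Nat.succ_pos C) hlt).trans (h C)
  rw [pow_succ, mul_comm] at h1
  exact absurd (Nat.le_of_mul_le_mul_right h1 (by positivity)) (by lia)

open MvPolynomial in
theorem algebraicIndependent_iff_linearIndependent_monomials {F A ι : Type*} [CommRing F]
    [CommRing A] [Algebra F A] {x : ι → A} :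
    AlgebraicIndependent F x ↔
      LinearIndependent F fun α : ι →₀ ℕ => α.prod fun i e => x i ^ e := by
  have key : (fun α : ι →₀ ℕ => α.prod fun i e => x i ^ e) =
      (aeval x : MvPolynomial ι F →ₐ[F] A).toLinearMap ∘ basisMonomials ι F := by
    funext α
    simp [aeval_monomial]
  rw [key]
  constructor
  · intro h
    exact (basisMonomials ι F).linearIndependent.map' _ (LinearMap.ker_eq_bot.2 h)
  · intro h
    have h' := (basisMonomials ι F).injective_constr_of_linearIndependent (R₂ := F)
      (v := (aeval x : MvPolynomial ι F →ₐ[F] A).toLinearMap ∘ basisMonomials ι F) h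
    have e : (basisMonomials ι F).constr F
        ((aeval x : MvPolynomial ι F →ₐ[F] A).toLinearMap ∘ basisMonomials ι F) =
        (aeval x : MvPolynomial ι F →ₐ[F] A).toLinearMap :=
      (basisMonomials ι F).ext fun i => (basisMonomials ι F).constr_basis F _ i
    rw [e] at h'
    exact h'

theorem AlgebraicIndependent.linearIndependent_monomials_box {F A ι : Type*} [CommRing F]
    [CommRing A] [Algebra F A] [Fintype ι] {x : ι → A} (h : AlgebraicIndependent F x) (m : ℕ) :
    LinearIndependent F fun α : ι → Fin (m + 1) => ∏ i, x i ^ (α i : ℕ) := by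
  have hinj : Function.Injective fun α : ι → Fin (m + 1) =>
      Finsupp.equivFunOnFinite.symm fun i => (α i : ℕ) := by
    intro α β hab
    funext i
    exact Fin.ext (congrFun (Finsupp.equivFunOnFinite.symm.injective hab) i)
  have := (algebraicIndependent_iff_linearIndependent_monomials.1 h).comp _ hinj
  convert this using 2 with α
  simp [Finsupp.prod_fintype]

theorem exists_algebraicIndependent_of_trdeg_eq {R A : Type*} [CommRing R] [Nontrivial R]
    [CommRing A] [IsDomain A] [Algebra R A] [FaithfulSMul R A] {r : ℕ}
    (hr : Algebra.trdeg R A = r) : ∃ x : Fin r → A, AlgebraicIndependent R x := by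
  obtain ⟨s, hs⟩ := exists_isTranscendenceBasis R A
  have hsr : Cardinal.mk s = r := hs.cardinalMk_eq_trdeg.trans hr
  obtain ⟨σ⟩ : Nonempty (s ≃ Fin r) := by
    rw [← Cardinal.lift_mk_eq']
    simpa using hsr
  exact ⟨_, hs.1.comp _ σ.symm.injective⟩

theorem setTrdeg_subalgebra {F A : Type*} [Field F] [CommRing A] [Algebra F A]
    (R : Subalgebra F A) : setTrdeg F (R : Set A) = Algebra.trdeg F R := by
  apply le_antisymm
  · refine ciSup_le' fun s => ?_
    have h : AlgebraicIndependent F fun x : s.1 => (⟨x, s.2.1 x.2⟩ : R) :=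
      AlgebraicIndependent.of_comp R.val s.2.2
    exact h.cardinalMk_le_trdeg
  · refine ciSup_le' fun s => ?_
    have h : AlgebraicIndependent F (R.val ∘ ((↑) : s.1 → R)) :=
      s.2.map' Subtype.val_injective
    have hr := h.coe_range
    have hle : Set.range (R.val ∘ ((↑) : s.1 → R)) ⊆ R := by
      rintro _ ⟨x, rfl⟩
      exact x.1.2
    have hc : Cardinal.mk s.1 = Cardinal.mk (Set.range (R.val ∘ ((↑) : s.1 → R))) :=
      (Cardinal.mk_range_eq _ (Subtype.val_injective.comp Subtype.val_injective)).symm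
    rw [hc]
    exact le_ciSup (f := fun s : {s : Set A // s ⊆ R ∧ AlgebraicIndependent F ((↑) : s → A)} =>
      Cardinal.mk s.1) Cardinal.bddAbove_of_small ⟨_, hle, hr⟩

section Growth

variable {F A : Type*} [Field F] [CommRing A] [Algebra F A] {n t : ℕ}

/-- The span of the products `g (z ^ α) * w j`, where all exponents in `α` are at most `N`. -/
def boxSpan (g : MvPolynomial (Fin n) F →ₐ[F] A) (w : Fin t → A) (N : ℕ) : Submodule F A :=
  Submodule.span F {x | ∃ α : Fin n →₀ ℕ, (∀ i, α i ≤ N) ∧ ∃ j,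
    x = g (MvPolynomial.monomial α 1) * w j}

variable (g : MvPolynomial (Fin n) F →ₐ[F] A) (w : Fin t → A)

theorem boxSpan_mono {M N : ℕ} (h : M ≤ N) : boxSpan g w M ≤ boxSpan g w N := by
  refine Submodule.span_mono ?_
  rintro x ⟨α, hα, j, rfl⟩
  exact ⟨α, fun i => (hα i).trans h, j, rfl⟩

theorem monomial_mul_mem_boxSpan {M N : ℕ} {α : Fin n →₀ ℕ} (hα : ∀ i, α i ≤ M) {a : A}
    (ha : a ∈ boxSpan g w N) : g (MvPolynomial.monomial α 1) * a ∈ boxSpan g w (M + N) := by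
  induction ha using Submodule.span_induction with
  | mem x hx =>
    obtain ⟨β, hβ, j, rfl⟩ := hx
    refine Submodule.subset_span ⟨α + β, fun i => add_le_add (hα i) (hβ i), j, ?_⟩
    rw [← mul_assoc, ← map_mul, MvPolynomial.monomial_mul, one_mul]
  | zero => simp
  | add x y _ _ hx hy => rw [mul_add]; exact add_mem hx hy
  | smul c x _ hx => rw [mul_smul_comm]; exact Submodule.smul_mem _ _ hx

theorem boxSpan_mul_le {D : ℕ} (hD : ∀ i j, w i * w j ∈ boxSpan g w D) (M N : ℕ) :
    boxSpan g w M * boxSpan g w N ≤ boxSpan g w (M + N + D) := by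
  rw [Submodule.mul_le]
  intro a ha b hb
  induction ha using Submodule.span_induction with
  | mem x hx =>
    obtain ⟨α, hα, i, rfl⟩ := hx
    rw [mul_assoc, add_assoc]
    refine monomial_mul_mem_boxSpan g w hα ?_
    induction hb using Submodule.span_induction with
    | mem x hx =>
      obtain ⟨β, hβ, j, rfl⟩ := hx
      rw [mul_left_comm]
      exact monomial_mul_mem_boxSpan g w hβ (hD i j)
    | zero => simp
    | add x y _ _ hx hy => rw [mul_add]; exact add_mem hx hy
    | smul c x _ hx => rw [mul_smul_comm]; exact Submodule.smul_mem _ _ hx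
  | zero => simp
  | add x y _ _ hx hy => rw [add_mul]; exact add_mem hx hy
  | smul c x _ hx => rw [smul_mul_assoc]; exact Submodule.smul_mem _ _ hx

theorem exists_mem_boxSpan (hw : ∀ a, ∃ p : Fin t → MvPolynomial (Fin n) F, a = ∑ j, g (p j) * w j)
    (a : A) : ∃ N, a ∈ boxSpan g w N := by
  obtain ⟨p, rfl⟩ := hw a
  have hp : ∀ j, ∃ N, g (p j) * w j ∈ boxSpan g w N := by
    intro j
    induction p j using MvPolynomial.induction_on' with
    | monomial α c =>
      refine ⟨α.degree, ?_⟩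
      have : MvPolynomial.monomial α c = c • MvPolynomial.monomial α (1 : F) := by
        rw [MvPolynomial.smul_monomial, smul_eq_mul, mul_one]
      rw [this, map_smul, smul_mul_assoc]
      exact Submodule.smul_mem _ _
        (Submodule.subset_span ⟨α, fun i => Finsupp.le_degree i α, j, rfl⟩)
    | add p q hp hq =>
      obtain ⟨M, hM⟩ := hp
      obtain ⟨N, hN⟩ := hq
      refine ⟨M + N, ?_⟩
      rw [map_add, add_mul]
      exact add_mem (boxSpan_mono g w (by lia) hM) (boxSpan_mono g w (by lia) hN)
  choose N hN using hp
  exact ⟨∑ j, N j, sum_mem fun j hj =>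
    boxSpan_mono g w (Finset.single_le_sum (fun _ _ => Nat.zero_le _) hj) (hN j)⟩

theorem card_le_of_linearIndependent_of_mem_boxSpan {N : ℕ} {ι : Type*} [Fintype ι] {v : ι → A}
    (hv : LinearIndependent F v) (hmem : ∀ i, v i ∈ boxSpan g w N) :
    Fintype.card ι ≤ t * (N + 1) ^ n := by
  let f : (Fin n → Fin (N + 1)) × Fin t → A := fun q =>
    g (MvPolynomial.monomial (Finsupp.equivFunOnFinite.symm fun i => (q.1 i : ℕ)) 1) * w q.2
  have hle : boxSpan g w N ≤ Submodule.span F (Set.range f) := by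
    refine Submodule.span_mono ?_
    rintro x ⟨α, hα, j, rfl⟩
    refine ⟨⟨fun i => ⟨α i, Nat.lt_succ_of_le (hα i)⟩, j⟩, ?_⟩
    simp [f]
  have hle' : Submodule.span F (Set.range v) ≤ Submodule.span F (Set.range f) :=
    (Submodule.span_le.2 (by rintro _ ⟨i, rfl⟩; exact hmem i)).trans hle
  calc Fintype.card ι = Module.finrank F (Submodule.span F (Set.range v)) :=
        (finrank_span_eq_card hv).symm
    _ ≤ Module.finrank F (Submodule.span F (Set.range f)) :=
        haveI := FiniteDimensional.span_of_finite F (Set.finite_range f)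
        Submodule.finrank_mono hle'
    _ ≤ Fintype.card ((Fin n → Fin (N + 1)) × Fin t) := finrank_range_le_card f
    _ = t * (N + 1) ^ n := by simp [mul_comm]

theorem exists_card_le_of_mem_pow [IsDomain A] [Algebra.FiniteType F A] {V : Submodule F A}
    (hV : V.FG) : ∃ n t K : ℕ, Algebra.trdeg F A = n ∧ ∀ (k : ℕ) {ι : Type} [Fintype ι]
      (v : ι → A), LinearIndependent F v → (∀ i, v i ∈ V ^ k) →
        Fintype.card ι ≤ t * (K * (k + 1) + 1) ^ n := by
  obtain ⟨n, g, hg, hfin⟩ := exists_finite_inj_algHom_of_fg F A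
  have htr : Algebra.trdeg F A = n := by
    algebraize [g.toRingHom]
    have hfaith : FaithfulSMul (MvPolynomial (Fin n) F) A :=
      (faithfulSMul_iff_algebraMap_injective _ _).2 hg
    have : Module.Finite (MvPolynomial (Fin n) F) A := hfin
    have : IsScalarTower F (MvPolynomial (Fin n) F) A :=
      IsScalarTower.of_algebraMap_eq fun c => (g.commutes c).symm
    have h := lift_trdeg_add_eq F (MvPolynomial (Fin n) F) A
    rw [trdeg_eq_zero (R := MvPolynomial (Fin n) F), MvPolynomial.trdeg_of_isDomain] at h
    simpa using h.symm
  obtain ⟨t, w, hw⟩ : ∃ (t : ℕ) (w : Fin t → A),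
      ∀ a, ∃ p : Fin t → MvPolynomial (Fin n) F, a = ∑ j, g (p j) * w j := by
    algebraize [g.toRingHom]
    have : Module.Finite (MvPolynomial (Fin n) F) A := hfin
    obtain ⟨t, w, hw⟩ := Module.Finite.exists_fin (R := MvPolynomial (Fin n) F) (M := A)
    refine ⟨t, w, fun a => ?_⟩
    have ha : a ∈ Submodule.span (MvPolynomial (Fin n) F) (Set.range w) := hw ▸ Submodule.mem_top
    obtain ⟨p, rfl⟩ := (Submodule.mem_span_range_iff_exists_fun _).1 ha
    exact ⟨p, Finset.sum_congr rfl fun j _ => Algebra.smul_def _ _⟩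
  have hdir : ∀ s : Finset A, ∃ N, ∀ a ∈ s, a ∈ boxSpan g w N := by
    intro s
    choose N hN using exists_mem_boxSpan g w hw
    exact ⟨∑ a ∈ s, N a, fun a ha =>
      boxSpan_mono g w (Finset.single_le_sum (fun _ _ => Nat.zero_le _) ha) (hN a)⟩
  obtain ⟨D, hD⟩ := hdir
    (Set.finite_range fun q : Fin t × Fin t => w q.1 * w q.2).toFinset
  obtain ⟨s, rfl⟩ := hV
  obtain ⟨E, hE⟩ := hdir s
  obtain ⟨E', hE'⟩ := exists_mem_boxSpan g w hw 1
  have hpow : ∀ k, Submodule.span F (s : Set A) ^ k ≤ boxSpan g w (E' + k * (E + D)) := by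
    intro k
    induction k with
    | zero =>
      rw [pow_zero, Submodule.one_le]
      exact boxSpan_mono g w (by lia) hE'
    | succ k ih =>
      rw [pow_succ]
      refine (mul_le_mul' ih (Submodule.span_le.2 hE)).trans
        ((boxSpan_mul_le g w (fun i j => hD _ (by simp)) _ _).trans
          (boxSpan_mono g w ?_))
      exact le_of_eq (by ring)
  refine ⟨n, t, E' + E + D, htr, fun k ι _ v hv hmem => ?_⟩
  refine card_le_of_linearIndependent_of_mem_boxSpan g w hv fun i =>
    boxSpan_mono g w ?_ (hpow k (hmem i))
  nlinarith [Nat.zero_le (E' * k)]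

end Growth

section Graded

variable {F A : Type*} [Field F] [CommRing A] [Algebra F A] (𝒜 : ℕ → Submodule F A)
  [GradedAlgebra 𝒜]

theorem GradedAlgebra.proj_mul (n : ℕ) (a b : A) :
    proj 𝒜 n (a * b) =
      ∑ ij ∈ Finset.HasAntidiagonal.antidiagonal n, proj 𝒜 ij.1 a * proj 𝒜 ij.2 b := by
  simp only [proj_apply, decompose_mul, coe_mul_apply_eq_sum_antidiagonal]

theorem GradedAlgebra.proj_mem (n : ℕ) (a : A) : proj 𝒜 n a ∈ 𝒜 n := by
  rw [proj_apply]
  exact SetLike.coe_mem _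

theorem GradedAlgebra.exists_forall_lt_proj_eq_zero (a : A) :
    ∃ N, ∀ j, N < j → proj 𝒜 j a = 0 := by
  classical
  refine ⟨(decompose 𝒜 a).support.sup id, fun j hj => ?_⟩
  rw [proj_apply]
  by_contra h
  have : j ∈ (decompose 𝒜 a).support := by
    rw [DFinsupp.mem_support_iff]
    exact fun h' => h (by rw [h']; rfl)
  exact absurd (Finset.le_sup (f := id) this) (not_le.2 hj)

theorem GradedAlgebra.eq_sum_proj {a : A} {N : ℕ} (h : ∀ j, N < j → proj 𝒜 j a = 0) :
    a = ∑ k ∈ Finset.range (N + 1), proj 𝒜 k a := by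
  classical
  conv_lhs => rw [← sum_support_decompose 𝒜 a]
  refine Finset.sum_subset (fun k hk => ?_) fun k _ hk => ?_
  · rw [Finset.mem_range, Nat.lt_succ_iff]
    by_contra! hlt
    rw [DFinsupp.mem_support_iff] at hk
    exact hk (Subtype.ext (h k hlt))
  · rw [DFinsupp.notMem_support_iff.1 hk]
    rfl

/-- The elements all of whose homogeneous components have degree at most `N`. -/
def degreeLE (N : ℕ) : Submodule F A :=
  ⨅ j, ⨅ _ : N < j, LinearMap.ker (GradedAlgebra.proj 𝒜 j)

variable {𝒜}

theorem mem_degreeLE {N : ℕ} {a : A} :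
    a ∈ degreeLE 𝒜 N ↔ ∀ j, N < j → GradedAlgebra.proj 𝒜 j a = 0 := by
  simp [degreeLE, Submodule.mem_iInf]

theorem degreeLE_mono {M N : ℕ} (h : M ≤ N) : degreeLE 𝒜 M ≤ degreeLE 𝒜 N :=
  fun _ ha => mem_degreeLE.2 fun j hj => mem_degreeLE.1 ha j (h.trans_lt hj)

theorem one_mem_degreeLE (N : ℕ) : (1 : A) ∈ degreeLE 𝒜 N :=
  mem_degreeLE.2 fun j hj => by
    rw [GradedAlgebra.proj_apply]
    exact decompose_of_mem_ne 𝒜 SetLike.GradedOne.one_mem (by lia)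

theorem mul_mem_degreeLE {M N : ℕ} {a b : A} (ha : a ∈ degreeLE 𝒜 M) (hb : b ∈ degreeLE 𝒜 N) :
    a * b ∈ degreeLE 𝒜 (M + N) := by
  refine mem_degreeLE.2 fun k hk => ?_
  rw [GradedAlgebra.proj_mul]
  refine Finset.sum_eq_zero fun ij hij => ?_
  rw [Finset.HasAntidiagonal.mem_antidiagonal] at hij
  rcases lt_or_ge M ij.1 with h | h
  · rw [mem_degreeLE.1 ha _ h, zero_mul]
  · rw [mem_degreeLE.1 hb _ (by lia), mul_zero]

theorem pow_mem_degreeLE {N : ℕ} {a : A} (ha : a ∈ degreeLE 𝒜 N) (k : ℕ) :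
    a ^ k ∈ degreeLE 𝒜 (k * N) := by
  induction k with
  | zero => rw [pow_zero]; exact one_mem_degreeLE _
  | succ k ih =>
    rw [pow_succ, add_mul, one_mul]
    exact mul_mem_degreeLE ih ha

theorem prod_mem_degreeLE {ι : Type*} (s : Finset ι) {a : ι → A} {N : ι → ℕ}
    (h : ∀ i ∈ s, a i ∈ degreeLE 𝒜 (N i)) : ∏ i ∈ s, a i ∈ degreeLE 𝒜 (∑ i ∈ s, N i) := by
  classical
  induction s using Finset.induction_on with
  | empty => simpa using one_mem_degreeLE 0
  | insert i s hi ih =>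
    rw [Finset.prod_insert hi, Finset.sum_insert hi]
    exact mul_mem_degreeLE (h i (Finset.mem_insert_self i s))
      (ih fun j hj => h j (Finset.mem_insert_of_mem hj))

theorem exists_monomials_box_mem_degreeLE {ι : Type*} [Fintype ι] (a : ι → A) :
    ∃ C, ∀ (m : ℕ) (α : ι → Fin (m + 1)), ∏ i, a i ^ (α i : ℕ) ∈ degreeLE 𝒜 (C * m) := by
  choose N hN using fun i => GradedAlgebra.exists_forall_lt_proj_eq_zero 𝒜 (a i)
  refine ⟨∑ i, N i, fun m α => ?_⟩
  rw [Finset.sum_mul]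
  refine prod_mem_degreeLE _ fun i _ => ?_
  refine degreeLE_mono ?_ (pow_mem_degreeLE (mem_degreeLE.2 (hN i)) _)
  rw [mul_comm]
  exact Nat.mul_le_mul_left _ (Nat.lt_succ_iff.1 (α i).2)

variable (𝒜) in
theorem exists_degreeLE_le_pow [hfin : Algebra.FiniteType F A]
    (h0 : ∀ x ∈ 𝒜 0, ∃ c : F, x = algebraMap F A c) :
    ∃ V : Submodule F A, V.FG ∧ ∀ N, degreeLE 𝒜 N ≤ V ^ N := by
  classical
  obtain ⟨s, hs⟩ := hfin.out
  choose d hd using GradedAlgebra.exists_forall_lt_proj_eq_zero 𝒜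
  let T : Finset A := insert 1 (s.biUnion fun a =>
    (Finset.range (d a + 1)).image fun k => GradedAlgebra.proj 𝒜 k a)
  let V : Submodule F A := Submodule.span F (T : Set A)
  have h1 : (1 : Submodule F A) ≤ V :=
    Submodule.one_le.2 (Submodule.subset_span (Finset.mem_coe.2 (Finset.mem_insert_self _ _)))
  have hmono : ∀ {i j : ℕ}, i ≤ j → V ^ i ≤ V ^ j := fun h => pow_le_pow_right' h1 h
  have hgen : ∀ a ∈ s, ∀ k, GradedAlgebra.proj 𝒜 k a ∈ V := by
    intro a ha k
    rcases lt_or_ge (d a) k with h | h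
    · rw [hd a k h]; exact zero_mem _
    · refine Submodule.subset_span (Finset.mem_coe.2 (Finset.mem_insert_of_mem ?_))
      exact Finset.mem_biUnion.2
        ⟨a, ha, Finset.mem_image.2 ⟨k, Finset.mem_range.2 (by lia), rfl⟩⟩
  have hscalar : ∀ a ∈ 𝒜 0, ∀ k, a ∈ V ^ k := by
    intro a ha k
    obtain ⟨c, rfl⟩ := h0 a ha
    refine hmono (Nat.zero_le k) ?_
    rw [pow_zero]
    exact Submodule.algebraMap_mem c
  have hdeg0 : ∀ a ∈ 𝒜 0, ∀ k, GradedAlgebra.proj 𝒜 k a ∈ V ^ k := by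
    intro a ha k
    rw [GradedAlgebra.proj_apply]
    rcases eq_or_ne 0 k with rfl | h
    · rw [decompose_of_mem_same 𝒜 ha]; exact hscalar a ha 0
    · rw [decompose_of_mem_ne 𝒜 ha h]; exact zero_mem _
  have hall : ∀ a k, GradedAlgebra.proj 𝒜 k a ∈ V ^ k := by
    intro a
    have ha : a ∈ Algebra.adjoin F (s : Set A) := hs ▸ Algebra.mem_top
    induction ha using Algebra.adjoin_induction with
    | mem a ha =>
      intro k
      rcases Nat.eq_zero_or_pos k with rfl | hk
      · exact hscalar _ (GradedAlgebra.proj_mem 𝒜 0 a) 0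
      · refine hmono hk ?_
        rw [pow_one]
        exact hgen a ha k
    | algebraMap c => exact hdeg0 _ (SetLike.algebraMap_mem_graded 𝒜 c)
    | add a b _ _ ha hb => intro k; rw [map_add]; exact add_mem (ha k) (hb k)
    | mul a b _ _ ha hb =>
      intro k
      rw [GradedAlgebra.proj_mul]
      refine sum_mem fun ij hij => ?_
      rw [← Finset.HasAntidiagonal.mem_antidiagonal.1 hij, pow_add]
      exact Submodule.mul_mem_mul (ha _) (hb _)
  refine ⟨V, ⟨T, rfl⟩, fun N a ha => ?_⟩
  rw [GradedAlgebra.eq_sum_proj 𝒜 (mem_degreeLE.1 ha)]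
  exact sum_mem fun k hk => hmono (Nat.lt_succ_iff.1 (Finset.mem_range.1 hk)) (hall a k)

/-- `w` is the degree `k` component of `a`, and all components of smaller degree vanish. -/
def IsInitial (𝒜 : ℕ → Submodule F A) [GradedAlgebra 𝒜] (k : ℕ) (a w : A) : Prop :=
  (∀ j < k, GradedAlgebra.proj 𝒜 j a = 0) ∧ GradedAlgebra.proj 𝒜 k a = w

theorem IsInitial.one : IsInitial 𝒜 0 1 1 :=
  ⟨fun j hj => absurd hj (Nat.not_lt_zero j), by
    rw [GradedAlgebra.proj_apply]
    exact decompose_of_mem_same 𝒜 SetLike.GradedOne.one_mem⟩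

theorem IsInitial.mul {k l : ℕ} {a b v w : A} (ha : IsInitial 𝒜 k a v)
    (hb : IsInitial 𝒜 l b w) : IsInitial 𝒜 (k + l) (a * b) (v * w) := by
  constructor
  · intro n hn
    rw [GradedAlgebra.proj_mul]
    refine Finset.sum_eq_zero fun ij hij => ?_
    rw [Finset.HasAntidiagonal.mem_antidiagonal] at hij
    rcases lt_or_ge ij.1 k with h | h
    · rw [ha.1 _ h, zero_mul]
    · rw [hb.1 _ (by lia), mul_zero]
  · rw [GradedAlgebra.proj_mul, Finset.sum_eq_single (k, l), ha.2, hb.2]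
    · intro ij hij hne
      rw [Finset.HasAntidiagonal.mem_antidiagonal] at hij
      rcases lt_or_ge ij.1 k with h | h
      · rw [ha.1 _ h, zero_mul]
      · rw [hb.1 _ (by_contra fun h' => hne (Prod.ext (by lia) (by lia))), mul_zero]
    · exact fun h => absurd (Finset.HasAntidiagonal.mem_antidiagonal.2 (by rfl)) h

theorem IsInitial.pow {k : ℕ} {a w : A} (h : IsInitial 𝒜 k a w) (e : ℕ) :
    IsInitial 𝒜 (e * k) (a ^ e) (w ^ e) := by
  induction e with
  | zero => simpa using IsInitial.one
  | succ e ih =>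
    rw [pow_succ, pow_succ, add_mul, one_mul]
    exact ih.mul h

theorem IsInitial.prod {ι : Type*} (s : Finset ι) {k : ι → ℕ} {a w : ι → A}
    (h : ∀ i, IsInitial 𝒜 (k i) (a i) (w i)) :
    IsInitial 𝒜 (∑ i ∈ s, k i) (∏ i ∈ s, a i) (∏ i ∈ s, w i) := by
  classical
  induction s using Finset.induction_on with
  | empty => simpa using IsInitial.one
  | insert i s hi ih =>
    rw [Finset.prod_insert hi, Finset.prod_insert hi, Finset.sum_insert hi]
    exact (h i).mul ih

theorem IsInitial.mem {k : ℕ} {a w : A} (h : IsInitial 𝒜 k a w) : w ∈ 𝒜 k :=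
  h.2 ▸ GradedAlgebra.proj_mem 𝒜 k a

theorem linearIndependent_of_isInitial {ι : Type*} {k : ι → ℕ} {a w : ι → A}
    (h : ∀ i, IsInitial 𝒜 (k i) (a i) (w i)) (hw : LinearIndependent F w) :
    LinearIndependent F a := by
  classical
  rw [linearIndependent_iff']
  intro s c hc
  by_contra! hne
  obtain ⟨i₀, hi₀, hmin⟩ := (s.filter fun i => c i ≠ 0).exists_min_image k
    (hne.imp fun i hi => Finset.mem_filter.2 hi)
  rw [Finset.mem_filter] at hi₀
  have hsum := congrArg (GradedAlgebra.proj 𝒜 (k i₀)) hc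
  rw [map_sum, map_zero] at hsum
  have hsum' : ∑ i ∈ s, (if k i = k i₀ then c i else 0) • w i = 0 := by
    rw [← hsum]
    refine Finset.sum_congr rfl fun i hi => ?_
    rw [map_smul]
    by_cases hci : c i = 0
    · simp [hci]
    · rcases (hmin i (Finset.mem_filter.2 ⟨hi, hci⟩)).eq_or_lt with heq | hlt
      · rw [if_pos heq.symm, heq, (h i).2]
      · rw [if_neg hlt.ne', zero_smul, (h i).1 _ hlt, smul_zero]
  have := linearIndependent_iff'.1 hw s _ hsum' i₀ hi₀.1
  rw [if_pos rfl] at this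
  exact hi₀.2 this

theorem algebraicIndependent_of_isInitial {ι : Type*} {k : ι → ℕ} {a w : ι → A}
    (h : ∀ i, IsInitial 𝒜 (k i) (a i) (w i)) (hw : AlgebraicIndependent F w) :
    AlgebraicIndependent F a := by
  rw [algebraicIndependent_iff_linearIndependent_monomials] at hw ⊢
  exact linearIndependent_of_isInitial
    (fun α => IsInitial.prod α.support fun i => (h i).pow (α i)) hw

/-- The nonzero initial components of the elements of `R`. -/
def initialComponents (𝒜 : ℕ → Submodule F A) [GradedAlgebra 𝒜] (R : Subalgebra F A) : Set A :=
  {w | w ≠ 0 ∧ ∃ a ∈ R, ∃ k, IsInitial 𝒜 k a w}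

theorem trdeg_adjoin_initialComponents_le [IsDomain A] (R : Subalgebra F A) :
    Algebra.trdeg F (Algebra.adjoin F (initialComponents 𝒜 R)) ≤ Algebra.trdeg F R := by
  let S := initialComponents 𝒜 R
  have htop : Algebra.adjoin F ((↑) ⁻¹' S : Set (Algebra.adjoin F S)) = ⊤ :=
    Algebra.adjoin_adjoin_coe_preimage
  have : Algebra.IsAlgebraic (Algebra.adjoin F ((↑) ⁻¹' S : Set (Algebra.adjoin F S)))
      (Algebra.adjoin F S) :=
    ⟨fun x => isAlgebraic_algebraMap
      (⟨x, htop ▸ Algebra.mem_top⟩ : Algebra.adjoin F ((↑) ⁻¹' S : Set (Algebra.adjoin F S)))⟩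
  obtain ⟨T, hTS, hT⟩ := exists_isTranscendenceBasis_subset (R := F)
    ((↑) ⁻¹' S : Set (Algebra.adjoin F S))
  choose a haR k hk using fun x : T => (hTS x.2).2
  have hind := algebraicIndependent_of_isInitial hk
    (hT.1.map' (f := (Algebra.adjoin F S).val) Subtype.val_injective)
  have hindR : AlgebraicIndependent F fun x : T => (⟨a x, haR x⟩ : R) :=
    AlgebraicIndependent.of_comp R.val hind
  rw [← hT.cardinalMk_eq_trdeg]
  exact hindR.cardinalMk_le_trdeg

theorem span_initialComponents [IsDomain A] (R : Subalgebra F A) :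
    Submodule.span F (initialComponents 𝒜 R) =
      Subalgebra.toSubmodule (Algebra.adjoin F (initialComponents 𝒜 R)) := by
  refine (Algebra.adjoin_eq_span_of_subset F fun x hx => Submodule.subset_span ?_).symm
  induction hx using Submonoid.closure_induction with
  | mem x hx => exact hx
  | one => exact ⟨one_ne_zero, 1, one_mem R, 0, IsInitial.one⟩
  | mul x y _ _ hx hy =>
    obtain ⟨hx0, a, ha, k, hak⟩ := hx
    obtain ⟨hy0, b, hb, l, hbl⟩ := hy
    exact ⟨mul_ne_zero hx0 hy0, a * b, mul_mem ha hb, k + l, hak.mul hbl⟩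

/-- A linear map which is injective on `R` and sends the elements of `R` of degree at most `N` to
elements of degree at most `N` in the span of the initial components of `R`. -/
theorem exists_linearMap_span_initialComponents (R : Subalgebra F A) (N : ℕ) :
    ∃ f : A →ₗ[F] A, (∀ a, f a ∈ Submodule.span F (initialComponents 𝒜 R)) ∧
      (∀ a, f a ∈ degreeLE 𝒜 N) ∧ ∀ a ∈ R, a ∈ degreeLE 𝒜 N → f a = 0 → a = 0 := by
  classical
  set W := Submodule.span F (initialComponents 𝒜 R) with hW
  obtain ⟨q, hq⟩ := W.subtype.exists_leftInverse_of_injective W.ker_subtype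
  have hqW : ∀ w ∈ W, (q w : A) = w := fun w hw =>
    congrArg Subtype.val (LinearMap.congr_fun hq ⟨w, hw⟩)
  have hproj : ∀ w ∈ W, ∀ k, GradedAlgebra.proj 𝒜 k w ∈ W := by
    intro w hw k
    induction hw using Submodule.span_induction with
    | mem w hw =>
      obtain ⟨_, a, _, l, hl⟩ := id hw
      rw [GradedAlgebra.proj_apply]
      rcases eq_or_ne l k with rfl | h
      · rw [decompose_of_mem_same 𝒜 hl.mem]; exact Submodule.subset_span hw
      · rw [decompose_of_mem_ne 𝒜 hl.mem h]; exact zero_mem _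
    | zero => rw [map_zero]; exact zero_mem _
    | add x y _ _ hx hy => rw [map_add]; exact add_mem hx hy
    | smul c x _ hx => rw [map_smul]; exact Submodule.smul_mem _ _ hx
  let f : A →ₗ[F] A := ∑ k ∈ Finset.range (N + 1),
    GradedAlgebra.proj 𝒜 k ∘ₗ W.subtype ∘ₗ q ∘ₗ GradedAlgebra.proj 𝒜 k
  have hf : ∀ a, f a = ∑ k ∈ Finset.range (N + 1),
      GradedAlgebra.proj 𝒜 k (q (GradedAlgebra.proj 𝒜 k a)) := fun a => by
    simp [f, LinearMap.sum_apply]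
  have hcomp : ∀ a j, GradedAlgebra.proj 𝒜 j (f a) =
      if j ≤ N then GradedAlgebra.proj 𝒜 j (q (GradedAlgebra.proj 𝒜 j a)) else 0 := by
    intro a j
    rw [hf, map_sum]
    have hterm : ∀ k, GradedAlgebra.proj 𝒜 j
        (GradedAlgebra.proj 𝒜 k (q (GradedAlgebra.proj 𝒜 k a))) =
        if k = j then GradedAlgebra.proj 𝒜 j (q (GradedAlgebra.proj 𝒜 j a)) else 0 := by
      intro k
      have hm := GradedAlgebra.proj_mem 𝒜 k (q (GradedAlgebra.proj 𝒜 k a) : A)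
      rw [GradedAlgebra.proj_apply]
      split_ifs with h
      · subst h
        exact decompose_of_mem_same 𝒜 hm
      · exact decompose_of_mem_ne 𝒜 hm h
    simp only [hterm, Finset.sum_ite_eq', Finset.mem_range, Nat.lt_succ_iff]
  refine ⟨f, fun a => ?_, fun a => ?_, fun a haR haN hfa => ?_⟩
  · rw [hf]
    exact sum_mem fun k _ => hproj _ (SetLike.coe_mem _) k
  · exact mem_degreeLE.2 fun j hj => by rw [hcomp, if_neg (not_le.2 hj)]
  · by_contra hne
    have hex : ∃ j, GradedAlgebra.proj 𝒜 j a ≠ 0 := by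
      by_contra! hall
      exact hne ((GradedAlgebra.eq_sum_proj 𝒜 (mem_degreeLE.1 haN)).trans
        (Finset.sum_eq_zero fun k _ => hall k))
    have hk := Nat.find_spec hex
    have hlt : ∀ j < Nat.find hex, GradedAlgebra.proj 𝒜 j a = 0 :=
      fun j hj => not_not.1 (Nat.find_min hex hj)
    set k := Nat.find hex
    have hkN : k ≤ N := by
      by_contra! h
      exact hk (mem_degreeLE.1 haN k h)
    have hmem : GradedAlgebra.proj 𝒜 k a ∈ W :=
      Submodule.subset_span ⟨hk, a, haR, k, hlt, rfl⟩
    have := hcomp a k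
    rw [hfa, map_zero, if_pos hkN, hqW _ hmem, GradedAlgebra.proj_apply 𝒜 k (_ : A),
      decompose_of_mem_same 𝒜 (GradedAlgebra.proj_mem 𝒜 k a)] at this
    exact hk this.symm

theorem trdeg_le_trdeg_adjoin_initialComponents [IsDomain A] [Algebra.FiniteType F A]
    (h0 : ∀ x ∈ 𝒜 0, ∃ c : F, x = algebraMap F A c) (R : Subalgebra F A) :
    Algebra.trdeg F R ≤ Algebra.trdeg F (Algebra.adjoin F (initialComponents 𝒜 R)) := by
  set B := Algebra.adjoin F (initialComponents 𝒜 R) with hB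
  obtain ⟨V, hV, hVN⟩ := exists_degreeLE_le_pow 𝒜 h0
  obtain ⟨n, t, K, hn, hcard⟩ := exists_card_le_of_mem_pow hV
  have hadd : Algebra.trdeg F B + Algebra.trdeg B A = n := by
    rw [← hn]
    exact trdeg_add_eq F B
  have hR : Algebra.trdeg F R ≤ n := by
    rw [← hn]
    exact trdeg_le_of_injective R.val Subtype.val_injective
  obtain ⟨d, hd⟩ := Cardinal.lt_aleph0.1 (hR.trans_lt (Cardinal.natCast_lt_aleph0))
  obtain ⟨e, he⟩ := Cardinal.lt_aleph0.1
    ((hadd ▸ self_le_add_right _ _ : Algebra.trdeg F B ≤ n).trans_lt Cardinal.natCast_lt_aleph0)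
  obtain ⟨f, hf⟩ := Cardinal.lt_aleph0.1
    ((hadd ▸ self_le_add_left _ _ : Algebra.trdeg B A ≤ n).trans_lt Cardinal.natCast_lt_aleph0)
  have hef : e + f = n := by
    rw [he, hf] at hadd
    exact_mod_cast hadd
  obtain ⟨x, hx⟩ := exists_algebraicIndependent_of_trdeg_eq hd
  obtain ⟨y, hy⟩ := exists_algebraicIndependent_of_trdeg_eq hf
  have hx' := hx.map' (f := R.val) Subtype.val_injective
  obtain ⟨C₁, hC₁⟩ := exists_monomials_box_mem_degreeLE (𝒜 := 𝒜) (R.val ∘ x)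
  obtain ⟨C₂, hC₂⟩ := exists_monomials_box_mem_degreeLE (𝒜 := 𝒜) y
  have hkey : ∀ m : ℕ, (m + 1) ^ (d + f) ≤ t * (K * (C₁ * m + C₂ * m + 1) + 1) ^ n := by
    intro m
    obtain ⟨φ, hφB, hφdeg, hφ⟩ :=
      exists_linearMap_span_initialComponents (𝒜 := 𝒜) R (C₁ * m)
    let u : (Fin d → Fin (m + 1)) → B := fun α =>
      ⟨φ (∏ i, (R.val ∘ x) i ^ (α i : ℕ)), by
        have := hφB (∏ i, (R.val ∘ x) i ^ (α i : ℕ))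
        rwa [span_initialComponents] at this⟩
    have hu : LinearIndependent F u := by
      refine LinearIndependent.of_comp B.val.toLinearMap ?_
      refine (hx'.linearIndependent_monomials_box m).map (f := φ) ?_
      rw [Submodule.disjoint_def]
      intro a ha hker
      have hspan : Submodule.span F (Set.range fun α : Fin d → Fin (m + 1) =>
          ∏ i, (R.val ∘ x) i ^ (α i : ℕ)) ≤ Subalgebra.toSubmodule R ⊓ degreeLE 𝒜 (C₁ * m) := by
        rw [Submodule.span_le]
        rintro _ ⟨α, rfl⟩
        exact ⟨R.prod_mem fun i _ => pow_mem (x i).2 _, hC₁ m α⟩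
      exact hφ a (hspan ha).1 (hspan ha).2 hker
    have hprod := linearIndependent_smul hu (hy.linearIndependent_monomials_box m)
    have := hcard (C₁ * m + C₂ * m) _ hprod fun p => hVN _ (by
      rw [Algebra.smul_def]
      exact mul_mem_degreeLE (hφdeg _) (hC₂ m p.2))
    simpa [pow_add] using this
  have hle : d + f ≤ n := by
    refine Nat.le_of_forall_pow_le (C := t * (K * (C₁ + C₂ + 1) + 1) ^ n) fun m => ?_
    refine (hkey m).trans ?_
    rw [mul_assoc, ← mul_pow]
    refine Nat.mul_le_mul_left _ (Nat.pow_le_pow_left ?_ _)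
    nlinarith [Nat.zero_le (K * C₁), Nat.zero_le (K * C₂), Nat.zero_le (K * m)]
  rw [hd, he]
  exact_mod_cast (by lia : d ≤ e)

end Graded

/-- **Proposition 1.5.**
Let `A = ⊕_{k ≥ 0} A_k` be an affine graded integral domain over a field `F` with `A_0 = F`.
For an `F`-subalgebra `R` of `A`, let `R̃` be the `F`-span of the initial (lowest-degree
nonzero homogeneous) components of the nonzero elements of `R`.  Then
`tr.deg_F R̃ = tr.deg_F R`. -/
theorem trdeg_initial_components
    {F A : Type*} [Field F] [CommRing A] [IsDomain A] [Algebra F A]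
    (haff : Algebra.FiniteType F A)
    (𝒜 : ℕ → Submodule F A) [GradedAlgebra 𝒜]
    (h0 : ∀ x ∈ 𝒜 0, ∃ c : F, x = algebraMap F A c)
    (R : Subalgebra F A)
    (Rt : Submodule F A)
    (hRt : Rt = Submodule.span F
      {x : A | ∃ a ∈ R, a ≠ 0 ∧ ∃ k : ℕ,
        (∀ j < k, (DirectSum.decompose 𝒜 a j : A) = 0) ∧
        (DirectSum.decompose 𝒜 a k : A) ≠ 0 ∧
        x = (DirectSum.decompose 𝒜 a k : A)}) :
    setTrdeg F (Rt : Set A) = setTrdeg F (R : Set A) := by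
  have hset : {x : A | ∃ a ∈ R, a ≠ 0 ∧ ∃ k : ℕ,
      (∀ j < k, (DirectSum.decompose 𝒜 a j : A) = 0) ∧
      (DirectSum.decompose 𝒜 a k : A) ≠ 0 ∧
      x = (DirectSum.decompose 𝒜 a k : A)} = initialComponents 𝒜 R := by
    ext x
    constructor
    · rintro ⟨a, ha, -, k, hlt, hne, rfl⟩
      exact ⟨hne, a, ha, k, hlt, rfl⟩
    · rintro ⟨hne, a, ha, k, hlt, rfl⟩
      refine ⟨a, ha, ?_, k, hlt, hne, rfl⟩
      rintro rfl
      exact hne (map_zero _)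
  rw [hRt, hset, span_initialComponents, Subalgebra.coe_toSubmodule, setTrdeg_subalgebra,
    setTrdeg_subalgebra]
  exact le_antisymm (trdeg_adjoin_initialComponents_le R)
    (trdeg_le_trdeg_adjoin_initialComponents h0 R)
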